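/- Let ω ∈ ℂ with Im ω > 0, let Λ = {n + m·ω : n, m ∈ ℤ} ⊂ ℂ, and let a, b ∈ ℂ satisfy a·Λ ⊆ Λ and |a|² ≥ 2. Let A : ℂ/Λ → ℂ/Λ be the map induced by z ↦ a·z + b. If E ⊆ ℂ/Λ is an eventually simply-connected wandering continuum for A, then E is a line segment: there exists a nondegenerate line segment B ⊂ ℂ on which the quotient map π is injective with E = π(B). -/

import Mathlib

open Complex

/-- The lattice Λ = {n + m·ω : n, m ∈ ℤ} as an additive subgroup of ℂ. -/
noncomputable def Lambda (ω : ℂ) : AddSubgroup ℂ where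
  carrier := {z : ℂ | ∃ n m : ℤ, z = (n : ℂ) + (m : ℂ) * ω}
  add_mem' := by
    rintro x y ⟨n1, m1, rfl⟩ ⟨n2, m2, rfl⟩
    exact ⟨n1 + n2, m1 + m2, by push_cast; ring⟩
  zero_mem' := ⟨0, 0, by simp⟩
  neg_mem' := by
    rintro x ⟨n, m, rfl⟩
    exact ⟨-n, -m, by push_cast; ring⟩

/-- The quotient map π : ℂ → ℂ/Λ. -/
noncomputable def pr (ω : ℂ) : ℂ → ℂ ⧸ Lambda ω := QuotientAddGroup.mk' (Lambda ω)

/-- A line in ℂ. -/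
def IsLine (L : Set ℂ) : Prop :=
  ∃ z₀ v : ℂ, v ≠ 0 ∧ L = {z | ∃ t : ℝ, z = z₀ + t * v}

/-- A nondegenerate line segment in ℂ. -/
def IsSegment (B : Set ℂ) : Prop :=
  ∃ z₀ v : ℂ, v ≠ 0 ∧ B = {z | ∃ t : ℝ, t ∈ Set.Icc (0 : ℝ) 1 ∧ z = z₀ + t * v}

/-- A continuum: a compact connected set with more than one point. -/
def IsContinuum {X : Type*} [TopologicalSpace X] (E : Set X) : Prop :=
  IsCompact E ∧ IsConnected E ∧ E.Nontrivial

/-- E is wandering for A. -/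
def Wandering {X : Type*} (A : X → X) (E : Set X) : Prop :=
  ∀ n m : ℕ, m < n → A^[n] '' E ∩ A^[m] '' E = ∅

/-- A continuum in the torus is simply-connected. -/
def IsSCContinuum (ω : ℂ) (E : Set (ℂ ⧸ Lambda ω)) : Prop :=
  ∃ U : Set (ℂ ⧸ Lambda ω), IsOpen U ∧ SimplyConnectedSpace U ∧ E ⊆ U ∧ IsConnected (U \ E)

/-- A continuous map from a preconnected set into a countable set is constant. -/
lemma eq_of_continuousOn_of_mapsTo_countable {X Y : Type*} [TopologicalSpace X]
    [TopologicalSpace Y] [T35Space Y] {S : Set X} (hS : IsPreconnected S) {f : X → Y}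
    (hf : ContinuousOn f S) {T : Set Y} (hT : T.Countable) (hfT : Set.MapsTo f S T)
    {x y : X} (hx : x ∈ S) (hy : y ∈ S) : f x = f y := by
  have hd : IsTotallyDisconnected T := by
    rw [← totallyDisconnectedSpace_subtype_iff]
    have : Countable T := hT
    infer_instance
  exact hd _ hfT.image_subset (hS.image f hf) (Set.mem_image_of_mem f hx)
    (Set.mem_image_of_mem f hy)

/-- A continuous self-map of the plane at bounded distance from the identity is surjective. -/
lemma exists_eq_of_norm_sub_le {f : ℂ → ℂ} (hf : Continuous f) {C : ℝ}
    (hC : ∀ z, ‖f z - z‖ ≤ C) (w : ℂ) : ∃ z, f z = w := by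
  by_contra! hne
  have hsc : IsSimplyConnected (Set.univ : Set ℂ) := by
    have : ContractibleSpace (Set.univ : Set ℂ) :=
      convex_univ.contractibleSpace Set.univ_nonempty
    exact inferInstanceAs (SimplyConnectedSpace _)
  obtain ⟨g, hgc, hg⟩ := exists_continuousOn_eqOn_exp_comp hsc isOpen_univ
    (g := fun z => f z - w) (by fun_prop) (by
      rintro ⟨z, -, hz⟩
      exact hne z (sub_eq_zero.1 hz))
  rw [continuousOn_univ] at hgc
  have hg' : ∀ z, exp (g z) = f z - w := fun z => hg (Set.mem_univ z)
  have hC0 : 0 ≤ C := (norm_nonneg _).trans (hC 0)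
  set R : ℝ := C + ‖w‖ + 1 with hR
  have hR0 : 0 < R := by positivity
  have hRC : (R : ℂ) ≠ 0 := by exact_mod_cast hR0.ne'
  let c : ℝ → ℂ := fun θ => R * exp (θ * I)
  have hc : Continuous c := by fun_prop
  have hc0 : ∀ θ, c θ ≠ 0 := fun θ => mul_ne_zero hRC (exp_ne_zero _)
  have hcn : ∀ θ, ‖c θ‖ = R := fun θ => by
    simp [c, norm_exp_ofReal_mul_I, abs_of_pos hR0]
  let r : ℝ → ℂ := fun θ => (f (c θ) - w) / c θ
  have hr : ∀ θ, r θ ∈ slitPlane := fun θ => by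
    have h1 : r θ = 1 + (f (c θ) - c θ - w) / c θ := by
      simp only [r]
      have := hc0 θ
      field_simp
      ring
    rw [h1]
    apply mem_slitPlane_of_norm_lt_one
    rw [norm_div, hcn, div_lt_one hR0]
    linarith [norm_sub_le (f (c θ) - c θ) w, hC (c θ)]
  have hrc : Continuous r := ((hf.comp hc).sub continuous_const).div hc hc0
  let k : ℝ → ℂ := fun θ => g (c θ) - log (r θ) - θ * I - log R
  have hk : Continuous k := by
    have := hrc.clog hr
    fun_prop
  have hk1 : ∀ θ, k θ ∈ Set.range (fun n : ℤ => (n : ℂ) * (2 * Real.pi * I)) := fun θ => by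
    have h1 : exp (k θ) = 1 := by
      have hr0 : r θ ≠ 0 := slitPlane_ne_zero (hr θ)
      have hfw : f (c θ) - w = r θ * c θ := (div_mul_cancel₀ _ (hc0 θ)).symm
      simp only [k, exp_sub, hg', exp_log hr0, exp_log hRC]
      rw [hfw]
      have := exp_ne_zero (θ * I)
      simp only [c]
      field_simp
    obtain ⟨n, hn⟩ := exp_eq_one_iff.1 h1
    exact ⟨n, hn.symm⟩
  have h := eq_of_continuousOn_of_mapsTo_countable isPreconnected_univ hk.continuousOn
    (Set.countable_range _) (fun θ _ => hk1 θ) (Set.mem_univ 0) (Set.mem_univ (2 * Real.pi))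
  have hcc : c (2 * Real.pi) = c 0 := by simp [c]
  have hrr : r (2 * Real.pi) = r 0 := by simp only [r, hcc]
  simp only [k, hcc, hrr] at h
  apply two_pi_I_ne_zero
  push_cast at h
  linear_combination h

/-- Two points joined inside `V` give a path in `V + ℤ e` at bounded distance from a line. -/
lemma exists_quasiperiodic_path {V : Set ℂ} {p e : ℂ} (h : JoinedIn V p (p + e)) :
    ∃ α : ℝ → ℂ, Continuous α ∧ (∃ C, ∀ x, ‖α x‖ ≤ C) ∧
      ∀ x : ℝ, ∃ n : ℤ, x * e + α x - n * e ∈ V := by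
  obtain ⟨γ, hγ⟩ := h
  let f : ℝ → ℂ := fun y => γ.extend y - y * e
  have hf : Continuous f := by
    have := γ.continuous_extend
    fun_prop
  refine ⟨f ∘ Int.fract, hf.continuousOn.comp_fract'' (by simp [f]), ?_, fun x => ⟨⌊x⌋, ?_⟩⟩
  · obtain ⟨C, hC⟩ := isCompact_Icc.exists_bound_of_continuousOn (s := Set.Icc (0 : ℝ) 1)
      hf.continuousOn
    exact ⟨C, fun x => hC _ ⟨Int.fract_nonneg x, (Int.fract_lt_one x).le⟩⟩
  · have hx : x * e + (f ∘ Int.fract) x - (⌊x⌋ : ℂ) * e = γ.extend (Int.fract x) := by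
      have : (x : ℂ) = (⌊x⌋ : ℂ) + (Int.fract x : ℝ) := by
        exact_mod_cast (Int.floor_add_fract x).symm
      simp only [f, Function.comp_apply]
      linear_combination e * this
    rw [hx, Path.extend_apply _ ⟨Int.fract_nonneg x, (Int.fract_lt_one x).le⟩]
    exact hγ _

/-- The coordinate of `w` along `e₁` in the basis `e₁, e₂`. -/
noncomputable def coordFst (e₁ e₂ w : ℂ) : ℝ :=
  (w.re * e₂.im - w.im * e₂.re) / (e₁.re * e₂.im - e₁.im * e₂.re)

lemma continuous_coordFst (e₁ e₂ : ℂ) : Continuous (coordFst e₁ e₂) := by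
  unfold coordFst
  fun_prop

lemma coordFst_add_coordFst {e₁ e₂ : ℂ} (h : e₁.re * e₂.im - e₁.im * e₂.re ≠ 0) (w : ℂ) :
    coordFst e₁ e₂ w * e₁ + coordFst e₂ e₁ w * e₂ = w := by
  have e : e₂.re * e₁.im - e₂.im * e₁.re = -(e₁.re * e₂.im - e₁.im * e₂.re) := by ring
  unfold coordFst
  rw [e]
  generalize hD : e₁.re * e₂.im - e₁.im * e₂.re = D at h ⊢
  apply Complex.ext <;> simp only [add_re, add_im, re_ofReal_mul, im_ofReal_mul] <;>
    field_simp <;> rw [← hD] <;> ring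

lemma coordFst_smul_add_smul {e₁ e₂ : ℂ} (h : e₁.re * e₂.im - e₁.im * e₂.re ≠ 0) (x y : ℝ) :
    coordFst e₁ e₂ (x * e₁ + y * e₂) = x := by
  unfold coordFst
  rw [div_eq_iff h]
  simp
  ring

/-- The lattice spanned by two independent vectors is closed. -/
lemma isClosed_intSpan {e₁ e₂ : ℂ} (h : e₁.re * e₂.im - e₁.im * e₂.re ≠ 0) :
    IsClosed (Set.range fun n : ℤ × ℤ => (n.1 : ℂ) * e₁ + n.2 * e₂) := by
  have h' : e₂.re * e₁.im - e₂.im * e₁.re ≠ 0 := fun h0 => h (by linear_combination -h0)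
  have hZ : IsClosed (Set.range ((↑) : ℤ → ℝ)) := Int.isClosedEmbedding_coe_real.isClosed_range
  convert (hZ.preimage (continuous_coordFst e₁ e₂)).inter
    (hZ.preimage (continuous_coordFst e₂ e₁)) using 1
  ext w
  constructor
  · rintro ⟨⟨m, n⟩, rfl⟩
    refine ⟨⟨m, ?_⟩, ⟨n, ?_⟩⟩
    · exact_mod_cast (coordFst_smul_add_smul h m n).symm
    · change _ = coordFst e₂ e₁ ((m : ℂ) * e₁ + n * e₂)
      rw [add_comm]
      exact_mod_cast (coordFst_smul_add_smul h' n m).symm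
  · rintro ⟨⟨m, hm⟩, ⟨n, hn⟩⟩
    refine ⟨(m, n), ?_⟩
    rw [← coordFst_add_coordFst h w, ← hm, ← hn]
    simp

/-- If an open connected set contains `p`, `p + e₁`, `p + e₂`, then its difference set meets every
coset of the lattice spanned by `e₁` and `e₂`. -/
lemma exists_sub_sub_eq_intSpan {V : Set ℂ} (hVo : IsOpen V) (hVc : IsConnected V) {p e₁ e₂ : ℂ}
    (hp : p ∈ V) (hp₁ : p + e₁ ∈ V) (hp₂ : p + e₂ ∈ V)
    (h : e₁.re * e₂.im - e₁.im * e₂.re ≠ 0) (w : ℂ) :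
    ∃ x ∈ V, ∃ y ∈ V, ∃ n : ℤ × ℤ, x - y + (n.1 * e₁ + n.2 * e₂) = w := by
  have hpc := hVo.isConnected_iff_isPathConnected.1 hVc
  obtain ⟨α, hα, ⟨C, hC⟩, hαV⟩ := exists_quasiperiodic_path (hpc.joinedIn p hp _ hp₁)
  obtain ⟨β, hβ, ⟨D, hD⟩, hβV⟩ := exists_quasiperiodic_path (hpc.joinedIn p hp _ hp₂)
  let f : ℂ → ℂ := fun z => z + α (coordFst e₁ e₂ z) - β (-coordFst e₂ e₁ z)
  have hf : Continuous f := by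
    have h1 := continuous_coordFst e₁ e₂
    have h2 := continuous_coordFst e₂ e₁
    fun_prop
  obtain ⟨z, hz⟩ := exists_eq_of_norm_sub_le hf (C := C + D) (fun z => by
    have : f z - z = α (coordFst e₁ e₂ z) - β (-coordFst e₂ e₁ z) := by simp only [f]; ring
    rw [this]
    exact (norm_sub_le _ _).trans (add_le_add (hC _) (hD _))) w
  obtain ⟨m, hm⟩ := hαV (coordFst e₁ e₂ z)
  obtain ⟨n, hn⟩ := hβV (-coordFst e₂ e₁ z)
  refine ⟨_, hm, _, hn, (m, -n), ?_⟩
  rw [← hz]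
  simp only [f]
  push_cast
  linear_combination coordFst_add_coordFst h z

open scoped Pointwise in
/-- The difference set of a planar continuum which is not contained in a line has an interior
point. -/
lemma nonempty_interior_sub_of_not_collinear {K : Set ℂ} (hK : IsCompact K)
    (hKc : IsConnected K) {p e₁ e₂ : ℂ} (hp : p ∈ K) (hp₁ : p + e₁ ∈ K) (hp₂ : p + e₂ ∈ K)
    (h : e₁.re * e₂.im - e₁.im * e₂.re ≠ 0) : (interior (K - K)).Nonempty := by
  have hKK : IsCompact (K - K) := by
    rw [← Set.sub_image_prod]
    exact (hK.prod hK).image continuous_sub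
  set L : Set ℂ := Set.range fun n : ℤ × ℤ => (n.1 : ℂ) * e₁ + n.2 * e₂ with hL
  have hcl : IsClosed (K - K + L) := (isClosed_intSpan h).add_left_of_isCompact hKK
  have hall : ∀ w, w ∈ K - K + L := by
    intro w
    rw [← hcl.closure_eq, Metric.mem_closure_iff]
    intro ε hε
    have hsub : K ⊆ Metric.thickening (ε / 2) K := Metric.self_subset_thickening (by positivity) K
    have hconn : IsConnected (Metric.thickening (ε / 2) K) := by
      rw [← add_ball_zero, ← Set.add_image_prod]
      exact (hKc.prod ((convex_ball _ _).isConnected (Metric.nonempty_ball.2 (by positivity)))).image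
        _ continuous_add.continuousOn
    obtain ⟨x, hx, y, hy, n, hn⟩ := exists_sub_sub_eq_intSpan Metric.isOpen_thickening hconn
      (hsub hp) (hsub hp₁) (hsub hp₂) h w
    obtain ⟨x', hx', hxx⟩ := Metric.mem_thickening_iff.1 hx
    obtain ⟨y', hy', hyy⟩ := Metric.mem_thickening_iff.1 hy
    refine ⟨x' - y' + (n.1 * e₁ + n.2 * e₂),
      Set.add_mem_add (Set.sub_mem_sub hx' hy') ⟨n, rfl⟩, ?_⟩
    rw [← hn, dist_add_right]
    exact (dist_sub_sub_le x y x' y').trans_lt (by linarith)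
  obtain ⟨n, x, hx⟩ := nonempty_interior_of_iUnion_of_closed
    (f := fun n : ℤ × ℤ => (fun z => z - ((n.1 : ℂ) * e₁ + n.2 * e₂)) ⁻¹' (K - K))
    (fun n => hKK.isClosed.preimage (by fun_prop)) (by
      refine Set.eq_univ_of_forall fun w => ?_
      obtain ⟨d, hd, _, ⟨n, rfl⟩, rfl⟩ := hall w
      exact Set.mem_iUnion.2 ⟨n, by simpa using hd⟩)
  refine ⟨x - ((n.1 : ℂ) * e₁ + n.2 * e₂), ?_⟩
  change x ∈ interior (Homeomorph.subRight ((n.1 : ℂ) * e₁ + n.2 * e₂) ⁻¹' (K - K)) at hx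
  rw [← Homeomorph.preimage_interior] at hx
  exact hx

/-- A nondegenerate continuum contained in a line is a segment. -/
lemma isSegment_of_collinear {K : Set ℂ} (hK : IsContinuum K)
    (h : ∀ p e₁ e₂ : ℂ, p ∈ K → p + e₁ ∈ K → p + e₂ ∈ K → e₁.re * e₂.im - e₁.im * e₂.re = 0) :
    IsSegment K := by
  obtain ⟨hc, hconn, p, hp, q, hq, hpq⟩ := hK
  have hv : q - p ≠ 0 := sub_ne_zero.2 hpq.symm
  let t : ℂ → ℝ := fun z => ((z - p) / (q - p)).re
  have ht : Continuous t := by fun_prop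
  have htz : ∀ z ∈ K, z = p + t z * (q - p) := fun z hz => by
    have him : ((z - p) / (q - p)).im = 0 := by
      have := h p (q - p) (z - p) hp (by simpa using hq) (by simpa using hz)
      rw [div_im, ← sub_div]
      simp only [div_eq_zero_iff]
      left
      linear_combination this
    have : ((t z : ℝ) : ℂ) = (z - p) / (q - p) := by
      apply Complex.ext <;> simp [t, him]
    rw [this]
    field_simp
    ring
  have himg : t '' K = Set.Icc (sInf (t '' K)) (sSup (t '' K)) :=
    eq_Icc_of_connected_compact (hconn.image t ht.continuousOn) (hc.image ht)
  set c := sInf (t '' K)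
  set d := sSup (t '' K)
  have h0 : (0 : ℝ) ∈ Set.Icc c d := himg ▸ ⟨p, hp, by simp [t]⟩
  have h1 : (1 : ℝ) ∈ Set.Icc c d := himg ▸ ⟨q, hq, by simp [t, hv]⟩
  have hcd : 0 < d - c := by linarith [h0.1, h1.2]
  refine ⟨p + c * (q - p), (d - c : ℝ) * (q - p),
    mul_ne_zero (by exact_mod_cast hcd.ne') hv, ?_⟩
  ext z
  constructor
  · intro hz
    have hm : t z ∈ Set.Icc c d := himg ▸ ⟨z, hz, rfl⟩
    refine ⟨(t z - c) / (d - c), ⟨div_nonneg (by linarith [hm.1]) hcd.le,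
      (div_le_one hcd).2 (by linarith [hm.2])⟩, ?_⟩
    have : (((t z - c) / (d - c) : ℝ) : ℂ) * ((d - c : ℝ) : ℂ) = t z - c := by
      rw [← ofReal_mul, div_mul_cancel₀ _ hcd.ne']
      push_cast
      rfl
    linear_combination htz z hz - (q - p) * this
  · rintro ⟨u, ⟨hu0, hu1⟩, rfl⟩
    have hm : c + u * (d - c) ∈ t '' K := by
      rw [himg]
      constructor <;> nlinarith
    obtain ⟨z, hz, hzt⟩ := hm
    convert hz using 1
    rw [htz z hz, hzt]
    push_cast
    ring

lemma pr_eq_pr_iff {ω z w : ℂ} : pr ω z = pr ω w ↔ z - w ∈ Lambda ω := by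
  rw [← neg_mem_iff, neg_sub, sub_eq_neg_add]
  exact QuotientAddGroup.eq

lemma pr_sub (ω z w : ℂ) : pr ω (z - w) = pr ω z - pr ω w :=
  map_sub (QuotientAddGroup.mk' (Lambda ω)) z w

lemma pr_surjective (ω : ℂ) : Function.Surjective (pr ω) :=
  QuotientAddGroup.mk'_surjective (Lambda ω)

lemma isQuotientMap_pr (ω : ℂ) : Topology.IsQuotientMap (pr ω) := isQuotientMap_quotient_mk'

lemma countable_Lambda (ω : ℂ) : (Lambda ω : Set ℂ).Countable := by
  refine (Set.countable_range fun n : ℤ × ℤ => (n.1 : ℂ) + n.2 * ω).mono ?_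
  rintro _ ⟨n, m, rfl⟩
  exact ⟨(n, m), rfl⟩

lemma discreteTopology_Lambda {ω : ℂ} (hω : 0 < ω.im) : DiscreteTopology (Lambda ω) := by
  apply discreteTopology_of_isOpen_singleton_zero
  have ho : IsOpen {z : ℂ | |z.im| < ω.im ∧ |z.re| < 1} :=
    (isOpen_lt continuous_im.abs continuous_const).and
      (isOpen_lt continuous_re.abs continuous_const)
  convert ho.preimage (continuous_subtype_val (p := (· ∈ Lambda ω)))
  ext ⟨z, n, m, rfl⟩
  simp only [Set.mem_singleton_iff, Set.mem_preimage, Set.mem_ofPred_eq]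
  constructor
  · intro h
    rw [Subtype.ext_iff] at h
    simp only [ZeroMemClass.coe_zero] at h
    simp [h, hω]
  · rintro ⟨him, hre⟩
    have hm : m = 0 := by
      simp only [add_im, intCast_im, zero_add, mul_im, intCast_re, zero_mul, add_zero, abs_mul,
        abs_of_pos hω] at him
      have : |(m : ℝ)| < 1 := by
        by_contra! h
        nlinarith
      exact Int.abs_lt_one_iff.1 (by exact_mod_cast this)
    subst hm
    have hn : n = 0 := by
      simp only [Int.cast_zero, zero_mul, add_zero, intCast_re] at hre
      exact Int.abs_lt_one_iff.1 (by exact_mod_cast hre)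
    subst hn
    simp

/-- The lattice is coarsely dense in the plane. -/
lemma exists_mem_Lambda_norm_sub_le {ω : ℂ} (hω : 0 < ω.im) (z : ℂ) :
    ∃ l ∈ Lambda ω, ‖z - l‖ ≤ 1 + ‖ω‖ := by
  let y : ℝ := z.im / ω.im
  let x : ℝ := z.re - y * ω.re
  have hz : z = x + y * ω := by
    have : y * ω.im = z.im := div_mul_cancel₀ _ hω.ne'
    apply Complex.ext <;> simp [x, this]
  refine ⟨⌊x⌋ + ⌊y⌋ * ω, ⟨⌊x⌋, ⌊y⌋, rfl⟩, ?_⟩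
  have hx : z - (⌊x⌋ + ⌊y⌋ * ω) = (Int.fract x : ℝ) + (Int.fract y : ℝ) * ω := by
    simp only [Int.fract]
    push_cast
    linear_combination hz
  rw [hx]
  refine (norm_add_le _ _).trans (add_le_add ?_ ?_)
  · rw [norm_real, Real.norm_of_nonneg (Int.fract_nonneg _)]
    exact (Int.fract_lt_one _).le
  · rw [norm_mul, norm_real, Real.norm_of_nonneg (Int.fract_nonneg _)]
    exact mul_le_of_le_one_left (norm_nonneg _) (Int.fract_lt_one _).le

/-- The preimages of a lattice under iterates of an expanding similarity become dense. -/
lemma exists_pow_mul_mem_Lambda {ω a : ℂ} (hω : 0 < ω.im) (ha : 1 < ‖a‖) {S : Set ℂ}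
    (hS : (interior S).Nonempty) (N : ℕ) :
    ∃ n ≥ N, ∃ c ∈ S, c ≠ 0 ∧ a ^ n * c ∈ Lambda ω := by
  have ha0 : a ≠ 0 := norm_pos_iff.1 (zero_lt_one.trans ha)
  obtain ⟨c, hc, hc0⟩ : ∃ c ∈ interior S, c ≠ 0 :=
    ((infinite_of_mem_nhds _ (isOpen_interior.mem_nhds hS.some_mem)).sdiff
      (Set.finite_singleton 0)).nonempty
  obtain ⟨ε, hε, hball⟩ := Metric.isOpen_iff.1 (isOpen_interior.sdiff isClosed_singleton) c ⟨hc, hc0⟩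
  obtain ⟨n, hn, hnN⟩ := (((tendsto_pow_atTop_atTop_of_one_lt ha).eventually_gt_atTop
    ((1 + ‖ω‖) / ε)).and (Filter.eventually_ge_atTop N)).exists
  obtain ⟨l, hl, hle⟩ := exists_mem_Lambda_norm_sub_le hω (a ^ n * c)
  have han : a ^ n ≠ 0 := pow_ne_zero n ha0
  have hmem : l / a ^ n ∈ Metric.ball c ε := by
    have h1 : c - l / a ^ n = (a ^ n * c - l) / a ^ n := by field_simp
    rw [Metric.mem_ball, dist_comm, dist_eq_norm, h1, norm_div, norm_pow, div_lt_iff₀ (by positivity)]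
    rw [div_lt_iff₀ hε] at hn
    linarith
  refine ⟨n, hnN, l / a ^ n, interior_subset (hball hmem).1, (hball hmem).2, ?_⟩
  rwa [mul_div_cancel₀ _ han]

/-- Over a simply connected continuum the universal covering of the torus has a section. -/
lemma IsSCContinuum.exists_section {ω : ℂ} (hω : 0 < ω.im) {F : Set (ℂ ⧸ Lambda ω)}
    (hF : IsSCContinuum ω F) :
    ∃ s : ℂ ⧸ Lambda ω → ℂ, ContinuousOn s F ∧ ∀ x ∈ F, pr ω (s x) = x := by
  classical
  obtain ⟨U, hUo, hUs, hFU, -⟩ := hF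
  have := discreteTopology_Lambda hω
  have hcov : IsCoveringMap (pr ω) :=
    (AddSubgroup.isAddQuotientCoveringMap_of_comm (Lambda ω) ⟨this⟩).isCoveringMap
  have : LocallyPathConnectedSpace (ℂ ⧸ Lambda ω) :=
    (isQuotientMap_pr ω).locallyPathConnectedSpace
  have := hUo.locallyPathConnectedSpace
  let x₀ : U := Classical.arbitrary U
  obtain ⟨e₀, he₀⟩ := pr_surjective ω x₀
  obtain ⟨G, ⟨-, hG⟩, -⟩ := hcov.existsUnique_continuousMap_lifts
    (⟨Subtype.val, continuous_subtype_val⟩ : C(U, ℂ ⧸ Lambda ω)) x₀ e₀ he₀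
  let s : ℂ ⧸ Lambda ω → ℂ := fun x => if hx : x ∈ U then G ⟨x, hx⟩ else 0
  have hs : ∀ x : U, s x = G x := fun x => by simp [s]
  refine ⟨s, ContinuousOn.mono ?_ hFU, fun x hx => ?_⟩
  · rw [continuousOn_iff_continuous_domRestrict]
    convert G.continuous
    exact funext hs
  · rw [hs ⟨x, hFU hx⟩]
    exact congrFun hG ⟨x, hFU hx⟩

/-- The covering projection is injective on a connected set over whose image it has a section. -/
lemma injOn_pr_of_section {ω : ℂ} {C : Set ℂ} (hC : IsPreconnected C)
    {s : ℂ ⧸ Lambda ω → ℂ} (hs : ContinuousOn s (pr ω '' C))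
    (hsec : ∀ x ∈ pr ω '' C, pr ω (s x) = x) : Set.InjOn (pr ω) C := by
  intro z hz w hw hzw
  have hcont : ContinuousOn (fun z => z - s (pr ω z)) C :=
    continuousOn_id.sub (hs.comp (isQuotientMap_pr ω).continuous.continuousOn
      (Set.mapsTo_image _ _))
  have h := eq_of_continuousOn_of_mapsTo_countable hC hcont (countable_Lambda ω)
    (fun z hz => pr_eq_pr_iff.1 (hsec _ (Set.mem_image_of_mem _ hz)).symm) hz hw
  simpa [hzw] using h

lemma iterate_mul_add (a b : ℂ) (n : ℕ) (z : ℂ) :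
    (fun z => a * z + b)^[n] z = a ^ n * z + (fun z => a * z + b)^[n] 0 := by
  induction n with
  | zero => simp
  | succ n ih =>
    rw [Function.iterate_succ_apply', Function.iterate_succ_apply', ih]
    ring

lemma iterate_pr {ω a b : ℂ} {A : ℂ ⧸ Lambda ω → ℂ ⧸ Lambda ω}
    (hA : ∀ z : ℂ, A (pr ω z) = pr ω (a * z + b)) (n : ℕ) (z : ℂ) :
    A^[n] (pr ω z) = pr ω (a ^ n * z + (fun z => a * z + b)^[n] 0) := by
  rw [← iterate_mul_add]
  exact (Function.Semiconj.iterate_right (f := pr ω) (fun z => (hA z).symm) n z).symm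

/-- A connected set some iterated image of which lies over a section carries a section itself. -/
lemma exists_section_of_iterate {ω a b : ℂ} (hω : 0 < ω.im) (ha : a ≠ 0)
    {A : ℂ ⧸ Lambda ω → ℂ ⧸ Lambda ω} (hA : ∀ z : ℂ, A (pr ω z) = pr ω (a * z + b))
    {E : Set (ℂ ⧸ Lambda ω)} (hE : IsConnected E) {N : ℕ} {s : ℂ ⧸ Lambda ω → ℂ}
    (hs : ContinuousOn s (A^[N] '' E)) (hsec : ∀ x ∈ A^[N] '' E, pr ω (s x) = x) :
    ∃ σ : ℂ ⧸ Lambda ω → ℂ, ContinuousOn σ E ∧ ∀ x ∈ E, pr ω (σ x) = x := by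
  have := discreteTopology_Lambda hω
  have : IsClosed (Lambda ω : Set ℂ) := AddSubgroup.isClosed_of_discrete
  have hπ := (isQuotientMap_pr ω).continuous
  have hAc : Continuous A := (isQuotientMap_pr ω).continuous_iff.2 (by
    have : A ∘ pr ω = pr ω ∘ fun z => a * z + b := funext hA
    rw [this]
    fun_prop)
  have haN : a ^ N ≠ 0 := pow_ne_zero N ha
  set d : ℂ := (fun z => a * z + b)^[N] 0 with hd
  let τ : ℂ ⧸ Lambda ω → ℂ := fun x => (s (A^[N] x) - d) / a ^ N
  have hτ : ContinuousOn τ E :=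
    ((hs.comp (hAc.iterate N).continuousOn (Set.mapsTo_image _ _)).sub
      continuousOn_const).div_const _
  let S : Set (ℂ ⧸ Lambda ω) := pr ω '' ((fun l => l / a ^ N) '' (Lambda ω : Set ℂ))
  have hS : S.Countable := ((countable_Lambda ω).image _).image _
  have hmaps : Set.MapsTo (fun x => x - pr ω (τ x)) E S := fun x hx => by
    obtain ⟨z, rfl⟩ := pr_surjective ω x
    refine ⟨z - τ (pr ω z), ⟨a ^ N * (z - τ (pr ω z)), ?_, by field_simp⟩, pr_sub _ _ _⟩
    have h1 := hsec _ (Set.mem_image_of_mem _ hx)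
    have h2 := iterate_pr hA N z
    rw [← hd] at h2
    rw [h2] at h1
    have h3 := pr_eq_pr_iff.1 h1.symm
    have h4 : a ^ N * (z - τ (pr ω z)) = a ^ N * z + d - s (pr ω (a ^ N * z + d)) := by
      simp only [τ, h2]
      field_simp
      ring
    rw [h4]
    exact h3
  obtain ⟨x₀, hx₀⟩ := hE.nonempty
  obtain ⟨μ, hμ⟩ := pr_surjective ω (x₀ - pr ω (τ x₀))
  refine ⟨fun x => μ + τ x, continuousOn_const.add hτ, fun x hx => ?_⟩
  have h := eq_of_continuousOn_of_mapsTo_countable hE.isPreconnected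
    (continuousOn_id.sub (hπ.comp_continuousOn hτ)) hS hmaps hx hx₀
  have hadd : pr ω (μ + τ x) = pr ω μ + pr ω (τ x) :=
    map_add (QuotientAddGroup.mk' (Lambda ω)) _ _
  rw [hadd, hμ]
  change x - pr ω (τ x) = x₀ - pr ω (τ x₀) at h
  rw [← h, sub_add_cancel]

/-- Lemma 3.3 (segment): an eventually simply-connected wandering continuum of an
affine torus covering is a line segment. -/
theorem wandering_continuum_is_segment (ω a b : ℂ) (hω : 0 < ω.im)
    (hab : ∀ z ∈ Lambda ω, a * z ∈ Lambda ω)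
    (hdeg : 2 ≤ Complex.normSq a)
    (A : ℂ ⧸ Lambda ω → ℂ ⧸ Lambda ω)
    (hA : ∀ z : ℂ, A (pr ω z) = pr ω (a * z + b))
    (E : Set (ℂ ⧸ Lambda ω)) (hE : IsContinuum E) (hW : Wandering A E)
    (hSC : ∃ N : ℕ, ∀ n ≥ N, IsSCContinuum ω (A^[n] '' E)) :
    ∃ B : Set ℂ, IsSegment B ∧ Set.InjOn (pr ω) B ∧ E = pr ω '' B := by
  have ha : 1 < ‖a‖ := by
    rw [normSq_eq_norm_sq] at hdeg
    nlinarith [norm_nonneg a]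
  have ha0 : a ≠ 0 := norm_pos_iff.1 (zero_lt_one.trans ha)
  obtain ⟨N, hN⟩ := hSC
  obtain ⟨s, hs, hsec⟩ := (hN N le_rfl).exists_section hω
  obtain ⟨σ, hσ, hσE⟩ := exists_section_of_iterate hω ha0 hA hE.2.1 hs hsec
  obtain ⟨hEc, hEconn, x, hx, y, hy, hxy⟩ := hE
  have hEK : pr ω '' (σ '' E) = E := by
    rw [Set.image_image]
    exact (Set.image_congr hσE).trans (Set.image_id' E)
  have hσinj : ∀ u ∈ E, ∀ v ∈ E, σ u = σ v → u = v := fun u hu v hv h => by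
    rw [← hσE u hu, h, hσE v hv]
  have hK : IsContinuum (σ '' E) := ⟨hEc.image_of_continuousOn hσ, hEconn.image σ hσ,
    σ x, ⟨x, hx, rfl⟩, σ y, ⟨y, hy, rfl⟩, fun h => hxy (hσinj x hx y hy h)⟩
  refine ⟨σ '' E, isSegment_of_collinear hK ?_, ?_, hEK.symm⟩
  · intro p e₁ e₂ hp hp₁ hp₂
    by_contra hne
    obtain ⟨n, hn, _, ⟨k, hk, k', hk', rfl⟩, hc0, hmem⟩ := exists_pow_mul_mem_Lambda hω ha
      (nonempty_interior_sub_of_not_collinear hK.1 hK.2.1 hp hp₁ hp₂ hne) N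
    set d : ℂ := (fun z => a * z + b)^[n] 0
    let T : ℂ → ℂ := fun z => a ^ n * z + d
    have hTE : pr ω '' (T '' (σ '' E)) = A^[n] '' E := by
      rw [← hEK, Set.image_image, Set.image_image (A^[n]), hEK]
      exact Set.image_congr fun z _ => (iterate_pr hA n z).symm
    obtain ⟨t, ht, htsec⟩ := (hN n hn).exists_section hω
    rw [← hTE] at ht htsec
    have hTc : Continuous T := by fun_prop
    have hinj := injOn_pr_of_section (hK.2.1.image T hTc.continuousOn).isPreconnected ht htsec
    have h := hinj (Set.mem_image_of_mem T hk) (Set.mem_image_of_mem T hk')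
      (pr_eq_pr_iff.2 (by convert hmem using 1; simp only [T]; ring))
    have h' : k = k' := by simpa [T, ha0] using h
    exact hc0 (sub_eq_zero.2 h')
  · rintro _ ⟨u, hu, rfl⟩ _ ⟨v, hv, rfl⟩ h
    rw [hσE u hu, hσE v hv] at h
    rw [h]
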